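/- Let n ≥ 2 and let ν ∈ ℂ^n be regular. Then for every m ∈ ℕ^n, c_{n,m}(ν) = Σ_{0 ≤ l_i ≤ m_i (1≤i≤n)} (−1)^{l_n} b_{(l_1,…,l_n)}(ν) / [ ∏_{i=1}^{n} (m_i−l_i)! · ∏_{i=1}^{n} (ν_i+ν_n+1)_{m_i−l_{i−1}} ], with the convention l_0 = 0. -/

import Mathlib

noncomputable section

open MeasureTheory Finset

namespace SO

/-- Extend a `Fin n`-indexed real tuple to a `1`-based function on `ℕ` (default value `0`). -/
def extR (n : ℕ) (t : Fin n → ℝ) : ℕ → ℝ :=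
  fun i => if h : 1 ≤ i ∧ i ≤ n then t ⟨i - 1, by omega⟩ else 0

/-- Extend a `Fin n`-indexed tuple of naturals to a `1`-based function on `ℕ` (default `0`). -/
def extN (n : ℕ) (t : Fin n → ℕ) : ℕ → ℕ :=
  fun i => if h : 1 ≤ i ∧ i ≤ n then t ⟨i - 1, by omega⟩ else 0

/-- The quadratic form `q_n(m, ν)`. -/
def qB (n : ℕ) (m : ℕ → ℕ) (ν : ℕ → ℂ) : ℂ :=
  (∑ i ∈ Finset.Icc 1 (n - 1), ((m i : ℂ)) ^ 2) + (1 / 2) * (m n : ℂ) ^ 2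
    - (∑ i ∈ Finset.Icc 1 (n - 1), (m i : ℂ) * (m (i + 1) : ℂ))
    + (∑ i ∈ Finset.Icc 1 (n - 1), (ν i - ν (i + 1)) * (m i : ℂ))
    + ν n * (m n : ℂ)

/-- Decrement the `i`-th coordinate by one. -/
def dec (m : ℕ → ℕ) (i : ℕ) : ℕ → ℕ := Function.update m i (m i - 1)

/-- Auxiliary (fuel-indexed) recursion computing the coefficients `c_{n,m}(ν)`. -/
def cAux (n : ℕ) (ν : ℕ → ℂ) : ℕ → (ℕ → ℕ) → ℂ
  | 0, _ => 1
  | d + 1, m =>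
      ((∑ i ∈ Finset.Icc 1 (n - 1), if m i = 0 then 0 else cAux n ν d (dec m i))
        + (1 / 2) * (if m n = 0 then 0 else cAux n ν d (dec m n))) / qB n m ν

/-- The coefficients `c_{n,m}(ν)`, determined by `c_{n,0} = 1` and the recurrence
`q_n(m,ν) c_{n,m}(ν) = ∑_{i=1}^{n-1} c_{n,m-e_i}(ν) + (1/2) c_{n,m-e_n}(ν)`. -/
def cB (n : ℕ) (ν : ℕ → ℂ) (m : ℕ → ℕ) : ℂ :=
  cAux n ν (∑ i ∈ Finset.Icc 1 n, m i) m

/-- Pochhammer symbol `(a)_k = Γ(a+k)/Γ(a)` for `k ∈ ℤ`. -/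
def poch (a : ℂ) (k : ℤ) : ℂ := Complex.Gamma (a + k) / Complex.Gamma a

/-- `z! ∈ ℂ` for `z ∈ ℤ`, with value `0` at negative integers (so that a factor `1/zfact z`
kills a summand containing the factorial of a negative integer). -/
def zfact (z : ℤ) : ℂ := if 0 ≤ z then (Nat.factorial z.toNat : ℂ) else 0

/-- `Γ_n(ν) = ∏_{1≤i<j≤n} Γ(-ν_i-ν_j)Γ(-ν_i+ν_j) ∏_{i=1}^n Γ(-2ν_i)`. -/
def GammaN (n : ℕ) (ν : ℕ → ℂ) : ℂ :=
  (∏ i ∈ Finset.Icc 1 n, ∏ j ∈ Finset.Icc (i + 1) n,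
      Complex.Gamma (-ν i - ν j) * Complex.Gamma (-ν i + ν j)) *
    ∏ i ∈ Finset.Icc 1 n, Complex.Gamma (-(2 * ν i))

/-- The Weyl group of type `B_n`: pairs of a permutation and a sign change. -/
abbrev SignedPerm (n : ℕ) := Equiv.Perm (Fin n) × (Fin n → Bool)

/-- Action of a signed permutation on `ν ∈ ℂ^n` (1-based indexing). -/
def wAct (n : ℕ) (w : SignedPerm n) (ν : ℕ → ℂ) : ℕ → ℂ :=
  fun i =>
    if h : 1 ≤ i ∧ i ≤ n then
      (if w.2 ⟨i - 1, by omega⟩ then -1 else 1) * ν ((w.1 ⟨i - 1, by omega⟩ : Fin n).val + 1)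
    else ν i

/-- Regularity of `ν ∈ ℂ^n`. -/
def Regular (n : ℕ) (ν : ℕ → ℂ) : Prop :=
  (∀ w : SignedPerm n, ∀ m : ℕ → ℕ,
      0 < ∑ i ∈ Finset.Icc 1 n, m i → qB n m (wAct n w ν) ≠ 0) ∧
    ∀ w w' : SignedPerm n, w ≠ w' →
      ¬ ∀ i ∈ Finset.Icc 1 n, ∃ k : ℤ, wAct n w ν i - wAct n w' ν i = (k : ℂ)

/-- The fundamental Whittaker power series `M̃^n_ν(y)`. -/
def Mt (n : ℕ) (ν : ℕ → ℂ) (y : ℕ → ℝ) : ℂ :=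
  ∑' m : Fin n → ℕ,
    cB n ν (extN n m) *
      ∏ i ∈ Finset.Icc 1 n,
        ((Real.pi * y i : ℝ) : ℂ) ^ (2 * ((extN n m i : ℂ) + ∑ j ∈ Finset.Icc 1 i, ν j))

/-- The modified Bessel function `K_s(z)` (for `Re z > 0`). -/
def besselK (s z : ℂ) : ℂ :=
  (1 / 2) * ∫ t in Set.Ioi (0 : ℝ),
    Complex.exp (-(z / 2) * ((t : ℂ) + 1 / (t : ℂ))) * (t : ℂ) ^ s / (t : ℂ)

/-- The positive orthant in `(ℝ)^n`. -/
def posSet (n : ℕ) : Set (Fin n → ℝ) := {t | ∀ i, 0 < t i}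

/-- The integrand in the recursive definition of `W̃^N_ν(y)`; `W` stands for `W̃^{N-1}_ν̃`. -/
def WtKernel (N : ℕ) (ν : ℕ → ℂ) (y : ℕ → ℝ) (W : (ℕ → ℝ) → ℂ)
    (t : Fin N → ℝ) (u : Fin (N - 1) → ℝ) : ℂ :=
  ((∏ i ∈ Finset.Icc 1 N,
      Real.exp (-(Real.pi * y i) ^ 2 * extR N t i - 1 / extR N t i) : ℝ) : ℂ) *
    (∏ i ∈ Finset.Icc 1 N, ((Real.pi * y i : ℝ) : ℂ) ^ (2 * ν N)) *
    ((∏ i ∈ Finset.Icc 1 (N - 1),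
        Real.exp (-(Real.pi * y i) ^ 2 * (extR N t i / extR N t (i + 1)) * extR (N - 1) u i
          - 1 / extR (N - 1) u i) : ℝ) : ℂ) *
    ((extR N t 1 : ℝ) : ℂ) ^ (2 * ν N) *
    (∏ i ∈ Finset.Icc 1 (N - 1),
      ((extR N t (i + 1) * extR (N - 1) u i : ℝ) : ℂ) ^ (ν N)) *
    W (fun j => if j = N - 1 then y N * Real.sqrt (extR N t N / extR (N - 1) u (N - 1))
        else y (j + 1) * Real.sqrt (extR N t (j + 1) * extR (N - 1) u (j + 1) /
          (extR N t (j + 2) * extR (N - 1) u j))) *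
    (((∏ i ∈ Finset.Icc 1 (N - 1), extR (N - 1) u i)⁻¹ : ℝ) : ℂ) *
    (((∏ i ∈ Finset.Icc 1 N, extR N t i)⁻¹ : ℝ) : ℂ)

/-- The class one Whittaker function `W̃^n_ν(y)`, defined recursively. -/
def Wt : ℕ → (ℕ → ℂ) → (ℕ → ℝ) → ℂ
  | 0, _, _ => 0
  | 1, ν, y => 2 * besselK (2 * ν 1) (2 * Real.pi * y 1)
  | n + 2, ν, y =>
      ∫ t in posSet (n + 2), ∫ u in posSet (n + 1),
        WtKernel (n + 2) ν y (fun z => Wt (n + 1) ν z) t u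

/-- The auxiliary function `V_ν(x)`. -/
def Vnu (n : ℕ) (ν : ℕ → ℂ) (x : ℕ → ℝ) : ℂ :=
  ∫ u in posSet (n - 1),
    ((∏ i ∈ Finset.Icc 1 (n - 1),
        Real.exp (-(Real.pi * x i) ^ 2 * extR (n - 1) u i - 1 / extR (n - 1) u i) : ℝ) : ℂ) *
      (∏ i ∈ Finset.Icc 1 n, ((Real.pi * x i : ℝ) : ℂ) ^ (2 * ν n)) *
      (∏ i ∈ Finset.Icc 1 (n - 1), ((extR (n - 1) u i : ℝ) : ℂ) ^ (ν n)) *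
      Wt (n - 1) ν (fun j => if j = n - 1 then x n * Real.sqrt (1 / extR (n - 1) u (n - 1))
          else x (j + 1) * Real.sqrt (extR (n - 1) u (j + 1) / extR (n - 1) u j)) *
      (((∏ i ∈ Finset.Icc 1 (n - 1), extR (n - 1) u i)⁻¹ : ℝ) : ℂ)

/-- The coefficients `b_l(ν)` (zero unless all `l_i ≥ 0` and `l_{n-1} ≥ l_n`). -/
def bB (n : ℕ) (ν : ℕ → ℂ) (l : ℕ → ℤ) : ℂ :=
  if (∀ i ∈ Finset.Icc 1 n, 0 ≤ l i) ∧ l n ≤ l (n - 1) then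
    (-1 : ℂ) ^ (l n) *
      ∑' k : Fin (n - 2) → ℕ,
        cB (n - 1) ν (fun i => if i = n - 1 then (l n).toNat else extN (n - 2) k i) /
          ((∏ i ∈ Finset.Icc 1 (n - 2), zfact (l i - (extN (n - 2) k i : ℤ))) *
            zfact (l (n - 1) - l n) *
            ∏ i ∈ Finset.Icc 1 (n - 1),
              poch (ν i - ν n + 1) (l i - (extN (n - 2) k (i - 1) : ℤ)))
  else 0

/-- The coefficients `b^P_l(ν)` (zero unless all `l_i ≥ 0` and `l_{n-1} ≥ l_n`). -/
def bP (n : ℕ) (P : Finset ℕ) (ν : ℕ → ℂ) (l : ℕ → ℤ) : ℂ :=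
  if (∀ i ∈ Finset.Icc 1 n, 0 ≤ l i) ∧ l n ≤ l (n - 1) then
    (-1 : ℂ) ^ (l n) *
      ∑' k : Fin (n - 2) → ℕ,
        cB (n - 1) ν (fun i => if i = n - 1 then (l n).toNat else extN (n - 2) k i) /
          ((∏ i ∈ (Finset.Icc 1 (n - 2)).filter (· ∈ P),
              zfact (l i - (extN (n - 2) k i : ℤ)) *
                poch (ν i - ν n + 1) (l i - (extN (n - 2) k (i - 1) : ℤ))) *
            (∏ i ∈ (Finset.Icc 1 (n - 2)).filter (· ∉ P),
              zfact (l i - (extN (n - 2) k (i - 1) : ℤ)) *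
                poch (-ν i + ν n + 1) (l i - (extN (n - 2) k i : ℤ))) *
            (if n - 1 ∈ P then
                zfact (l (n - 1) - l n) *
                  poch (ν (n - 1) - ν n + 1) (l (n - 1) - (extN (n - 2) k (n - 2) : ℤ))
              else
                zfact (l (n - 1) - (extN (n - 2) k (n - 2) : ℤ)) *
                  poch (-ν (n - 1) + ν n + 1) (l (n - 1) - l n)))
  else 0

/-- `ν^{(p)} = (ν_1, …, ν_{p-1}, ν_n, ν_p, …, ν_{n-1})`. -/
def nuP (n p : ℕ) (ν : ℕ → ℂ) : ℕ → ℂ :=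
  fun i => if i < p then ν i else if i = p then ν n else ν (i - 1)

/-- `ν̄^{(q)} = (ν_1, …, ν_{q-1}, -ν_n, ν_q, …, ν_{n-1})`. -/
def nuBar (n q : ℕ) (ν : ℕ → ℂ) : ℕ → ℂ :=
  fun i => if i < q then ν i else if i = q then -ν n else ν (i - 1)

/-- `Γ^P(ν)`. -/
def GammaP (n : ℕ) (P : Finset ℕ) (ν : ℕ → ℂ) : ℂ :=
  GammaN (n - 1) ν *
    (∏ i ∈ (Finset.Icc 1 (n - 1)).filter (· ∈ P), Complex.Gamma (-ν i + ν n)) *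
    ∏ i ∈ (Finset.Icc 1 (n - 1)).filter (· ∉ P), Complex.Gamma (ν i - ν n)

/-- `Γ^p(ν) = Γ^P(ν)` with `P = {1, …, p-1}`. -/
def Gammap (n p : ℕ) (ν : ℕ → ℂ) : ℂ := GammaP n (Finset.Icc 1 (p - 1)) ν

/-- `b^p_l(ν) = b^P_l(ν)` with `P = {1, …, p-1}`. -/
def bp (n p : ℕ) (ν : ℕ → ℂ) (l : ℕ → ℤ) : ℂ := bP n (Finset.Icc 1 (p - 1)) ν l

/-- `Γ^{p,Q}(ν)`. -/
def GammaPQ (n p : ℕ) (Q : Finset ℕ) (ν : ℕ → ℂ) : ℂ :=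
  Gammap n p ν *
    (∏ i ∈ (Finset.Icc 1 n).filter (· ∈ Q), Complex.Gamma (-(nuP n p ν i) - ν n)) *
    ∏ i ∈ (Finset.Icc 1 n).filter (· ∉ Q), Complex.Gamma (nuP n p ν i + ν n)

/-- The coefficients `c^{p,Q}_m(ν)` (zero if some `m_i < 0`). -/
def cPQ (n p : ℕ) (Q : Finset ℕ) (ν : ℕ → ℂ) (m : ℕ → ℤ) : ℂ :=
  if ∀ i ∈ Finset.Icc 1 n, 0 ≤ m i then
    ∑' l : Fin n → ℕ,
      (-1 : ℂ) ^ ((extN n l n : ℤ)) * bp n p ν (fun i => (extN n l i : ℤ)) /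
        ((∏ i ∈ (Finset.Icc 1 n).filter (· ∈ Q),
            zfact (m i - (extN n l i : ℤ)) *
              poch (nuP n p ν i + ν n + 1) (m i - (extN n l (i - 1) : ℤ))) *
          ∏ i ∈ (Finset.Icc 1 n).filter (· ∉ Q),
            zfact (m i - (extN n l (i - 1) : ℤ)) *
              poch (-(nuP n p ν i) - ν n + 1) (m i - (extN n l i : ℤ)))
  else 0

/-- The power series `M̃^{p,Q}_ν(y)`. -/
def MPQ (n p : ℕ) (Q : Finset ℕ) (ν : ℕ → ℂ) (y : ℕ → ℝ) : ℂ :=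
  ∑' m : Fin n → ℕ,
    cPQ n p Q ν (fun i => (extN n m i : ℤ)) *
      (∏ i ∈ (Finset.Icc 1 n).filter (· ∈ Q),
        ((Real.pi * y i : ℝ) : ℂ) ^
          (2 * ((extN n m i : ℂ) + ∑ j ∈ Finset.Icc 1 i, nuP n p ν j))) *
      ∏ i ∈ (Finset.Icc 1 n).filter (· ∉ Q),
        ((Real.pi * y i : ℝ) : ℂ) ^
          (2 * ((extN n m i : ℂ) + ∑ j ∈ Finset.Icc 1 (i - 1), nuP n p ν j - ν n))

/-- The Mellin-transform integrand. -/
def Tintegrand (n : ℕ) (ν : ℕ → ℂ) (s : ℕ → ℂ) (y : Fin n → ℝ) : ℂ :=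
  Wt n ν (extR n y) *
    (∏ i ∈ Finset.Icc 1 n, ((Real.pi * extR n y i : ℝ) : ℂ) ^ (2 * s i)) *
    (((∏ i ∈ Finset.Icc 1 n, extR n y i)⁻¹ : ℝ) : ℂ)

/-- The multiple Mellin transform `T^n_ν(s)` of the class one Whittaker function. -/
def Tn (n : ℕ) (ν : ℕ → ℂ) (s : ℕ → ℂ) : ℂ := ∫ y in posSet n, Tintegrand n ν s y


/-- Reciprocal factorial on the integers. -/
def rf (z : ℤ) : ℂ := (zfact z)⁻¹

/-- Reciprocal Pochhammer symbol. -/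
def rp (a : ℂ) (z : ℤ) : ℂ := (poch a z)⁻¹

lemma rf_pred (z : ℤ) : rf (z - 1) = z * rf z := by
  unfold rf zfact
  rcases lt_trichotomy z 0 with h | h | h
  · rw [if_neg (by omega), if_neg (by omega)]; simp
  · subst h; simp
  · obtain ⟨n, rfl⟩ : ∃ n : ℕ, z = n + 1 := ⟨(z - 1).toNat, by omega⟩
    rw [if_pos (by omega), if_pos (by omega)]
    have h1 : ((n : ℤ) + 1 - 1).toNat = n := by omega
    have h2 : ((n : ℤ) + 1).toNat = n + 1 := by omega
    rw [h1, h2, Nat.factorial_succ]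
    have : (n.factorial : ℂ) ≠ 0 := by exact_mod_cast n.factorial_ne_zero
    have h3 : (n : ℂ) + 1 ≠ 0 := by exact_mod_cast n.succ_ne_zero
    push_cast
    field_simp

lemma rf_zero : rf 0 = 1 := by simp [rf, zfact]

lemma rf_neg {z : ℤ} (h : z < 0) : rf z = 0 := by
  unfold rf zfact; rw [if_neg (by omega)]; simp

lemma rp_pred {a : ℂ} (ha : ∀ z : ℤ, a ≠ z) (z : ℤ) :
    rp a (z - 1) = (a + z - 1) * rp a z := by
  unfold rp poch
  have h0 : a + z - 1 ≠ 0 := by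
    intro h
    apply ha (1 - z)
    push_cast
    linear_combination h
  have h1 : Complex.Gamma (a + z) = (a + z - 1) * Complex.Gamma (a + z - 1) := by
    rw [← Complex.Gamma_add_one _ h0]; congr 1; ring
  push_cast
  rw [show a + ((z : ℂ) - 1) = a + z - 1 by ring, h1]
  rw [inv_div, inv_div, ← mul_div_assoc, mul_div_mul_left _ _ h0]

lemma rp_zero {a : ℂ} (ha : ∀ z : ℤ, a ≠ z) : rp a 0 = 1 := by
  unfold rp poch
  have : Complex.Gamma a ≠ 0 := Complex.Gamma_ne_zero (fun m h => ha (-m) (by simpa using h))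
  simp [this]

lemma prod_one_change {s : Finset ℕ} {j : ℕ} (hj : j ∈ s) {f g : ℕ → ℂ} {c d : ℂ}
    (hoff : ∀ i ∈ s, i ≠ j → f i = g i) (h : c * f j = d * g j) :
    c * ∏ i ∈ s, f i = d * ∏ i ∈ s, g i := by
  rw [← Finset.mul_prod_erase s f hj, ← Finset.mul_prod_erase s g hj, ← mul_assoc, h, mul_assoc]
  congr 2
  exact Finset.prod_congr rfl fun i hi => hoff i (Finset.mem_of_mem_erase hi)
    (Finset.ne_of_mem_erase hi)

/-- The integer version of the quadratic form. -/
def qZ (n : ℕ) (m : ℕ → ℤ) (ν : ℕ → ℂ) : ℂ :=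
  (∑ i ∈ Finset.Icc 1 (n - 1), ((m i : ℂ)) ^ 2) + (1 / 2) * (m n : ℂ) ^ 2
    - (∑ i ∈ Finset.Icc 1 (n - 1), (m i : ℂ) * (m (i + 1) : ℂ))
    + (∑ i ∈ Finset.Icc 1 (n - 1), (ν i - ν (i + 1)) * (m i : ℂ))
    + ν n * (m n : ℂ)

lemma qB_eq_qZ (n : ℕ) (m : ℕ → ℕ) (ν : ℕ → ℂ) : qB n m ν = qZ n (fun i => (m i : ℤ)) ν := by
  simp [qB, qZ]

/-- The kernel. -/
def F (ν : ℕ → ℂ) (N : ℕ) (m l k : ℕ → ℤ) : ℂ :=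
  (∏ i ∈ Icc 1 N, rf (m i - l i)) * (∏ i ∈ Icc 1 N, rf (l i - k i)) *
    (∏ i ∈ Icc 1 N, rp (ν i - ν (N + 1) + 1) (l i - k (i - 1))) *
    (∏ i ∈ Icc 1 (N + 1), rp (ν i + ν (N + 1) + 1) (m i - l (i - 1))) *
    rf (m (N + 1) - k N)

/-- Unit vector. -/
def e (j : ℕ) : ℕ → ℤ := Pi.single j 1

lemma e_self (j : ℕ) : e j j = 1 := by simp [e]

lemma e_ne {i j : ℕ} (h : i ≠ j) : e j i = 0 := by simp [e, h]

/-- Genericity. -/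
structure Good (ν : ℕ → ℂ) (N : ℕ) : Prop where
  minus : ∀ i ∈ Icc 1 N, ∀ z : ℤ, ν i - ν (N + 1) + 1 ≠ z
  plus : ∀ i ∈ Icc 1 (N + 1), ∀ z : ℤ, ν i + ν (N + 1) + 1 ≠ z

section
variable {ν : ℕ → ℂ} {N : ℕ}

lemma F_m (hg : Good ν N) (m l k : ℕ → ℤ) {j : ℕ} (hj : j ∈ Icc 1 N) :
    F ν N (m - e j) l k =
      ((m j : ℂ) - l j) * (ν j + ν (N + 1) + m j - l (j - 1)) * F ν N m l k := by
  have hj' := Finset.mem_Icc.1 hj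
  have h1 := prod_one_change hj (f := fun i => rf ((m - e j) i - l i))
    (g := fun i => rf (m i - l i)) (c := 1) (d := (m j : ℂ) - l j)
    (fun i _ hi => by simp [e_ne hi]) (by
      simp only [Pi.sub_apply, e_self]
      rw [show m j - 1 - l j = (m j - l j) - 1 by ring, rf_pred]; push_cast; ring)
  have hj2 : j ∈ Icc 1 (N + 1) := Finset.mem_Icc.2 ⟨hj'.1, by omega⟩
  have h2 := prod_one_change hj2
    (f := fun i => rp (ν i + ν (N + 1) + 1) ((m - e j) i - l (i - 1)))
    (g := fun i => rp (ν i + ν (N + 1) + 1) (m i - l (i - 1))) (c := 1)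
    (d := ν j + ν (N + 1) + m j - l (j - 1))
    (fun i _ hi => by simp [e_ne hi]) (by
      simp only [Pi.sub_apply, e_self]
      rw [show m j - 1 - l (j - 1) = (m j - l (j - 1)) - 1 by ring, rp_pred (hg.plus j hj2)]
      push_cast; ring)
  have h3 : (m - e j) (N + 1) = m (N + 1) := by simp [e_ne (show N + 1 ≠ j by omega)]
  rw [one_mul] at h1 h2
  unfold F
  rw [h1, h2, h3]
  ring

lemma F_m_last (hg : Good ν N) (m l k : ℕ → ℤ) :
    F ν N (m - e (N + 1)) l k =
      ((m (N + 1) : ℂ) - k N) * (2 * ν (N + 1) + m (N + 1) - l N) * F ν N m l k := by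
  have h1 : ∏ i ∈ Icc 1 N, rf ((m - e (N + 1)) i - l i) = ∏ i ∈ Icc 1 N, rf (m i - l i) :=
    Finset.prod_congr rfl fun i hi => by
      have := Finset.mem_Icc.1 hi
      simp [e_ne (show i ≠ N + 1 by omega)]
  have hj2 : N + 1 ∈ Icc 1 (N + 1) := Finset.mem_Icc.2 ⟨by omega, le_rfl⟩
  have h2 := prod_one_change hj2
    (f := fun i => rp (ν i + ν (N + 1) + 1) ((m - e (N + 1)) i - l (i - 1)))
    (g := fun i => rp (ν i + ν (N + 1) + 1) (m i - l (i - 1))) (c := 1)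
    (d := 2 * ν (N + 1) + m (N + 1) - l N)
    (fun i _ hi => by simp [e_ne hi]) (by
      simp only [Pi.sub_apply, e_self, Nat.add_sub_cancel]
      rw [show m (N + 1) - 1 - l N = (m (N + 1) - l N) - 1 by ring, rp_pred (hg.plus _ hj2)]
      push_cast; ring)
  have h3 : rf ((m - e (N + 1)) (N + 1) - k N) = ((m (N + 1) : ℂ) - k N) * rf (m (N + 1) - k N) := by
    simp only [Pi.sub_apply, e_self]
    rw [show m (N + 1) - 1 - k N = (m (N + 1) - k N) - 1 by ring, rf_pred]; push_cast; ring
  rw [one_mul] at h2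
  unfold F
  rw [h1, h2, h3]
  ring

lemma F_k (hg : Good ν N) (m l k : ℕ → ℤ) {j : ℕ} (hj : j ∈ Icc 1 (N - 1)) :
    F ν N m l (k + e j) =
      ((l j : ℂ) - k j) * (ν (j + 1) - ν (N + 1) + l (j + 1) - k j) * F ν N m l k := by
  have hj' := Finset.mem_Icc.1 hj
  have hj1 : j ∈ Icc 1 N := Finset.mem_Icc.2 ⟨hj'.1, by omega⟩
  have h1 := prod_one_change hj1 (f := fun i => rf (l i - (k + e j) i))
    (g := fun i => rf (l i - k i)) (c := 1) (d := (l j : ℂ) - k j)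
    (fun i _ hi => by simp [e_ne hi]) (by
      simp only [Pi.add_apply, e_self]
      rw [show l j - (k j + 1) = (l j - k j) - 1 by ring, rf_pred]; push_cast; ring)
  have hj2 : j + 1 ∈ Icc 1 N := Finset.mem_Icc.2 ⟨by omega, by omega⟩
  have h2 := prod_one_change hj2
    (f := fun i => rp (ν i - ν (N + 1) + 1) (l i - (k + e j) (i - 1)))
    (g := fun i => rp (ν i - ν (N + 1) + 1) (l i - k (i - 1))) (c := 1)
    (d := ν (j + 1) - ν (N + 1) + l (j + 1) - k j)
    (fun i hi' hi => by
      have := Finset.mem_Icc.1 hi'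
      simp [e_ne (show i - 1 ≠ j by omega)]) (by
      simp only [Pi.add_apply, e_self, Nat.add_sub_cancel]
      rw [show l (j + 1) - (k j + 1) = (l (j + 1) - k j) - 1 by ring, rp_pred (hg.minus _ hj2)]
      push_cast; ring)
  have h3 : (k + e j) N = k N := by simp [e_ne (show N ≠ j by omega)]
  rw [one_mul] at h1 h2
  unfold F
  rw [h1, h2, h3]
  ring

lemma F_k_last (hN : 1 ≤ N) (m l k : ℕ → ℤ) :
    F ν N m l (k + e N) =
      ((m (N + 1) : ℂ) - k N) * (l N - k N) * F ν N m l k := by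
  have hj1 : N ∈ Icc 1 N := Finset.mem_Icc.2 ⟨hN, le_rfl⟩
  have h1 := prod_one_change hj1 (f := fun i => rf (l i - (k + e N) i))
    (g := fun i => rf (l i - k i)) (c := 1) (d := (l N : ℂ) - k N)
    (fun i _ hi => by simp [e_ne hi]) (by
      simp only [Pi.add_apply, e_self]
      rw [show l N - (k N + 1) = (l N - k N) - 1 by ring, rf_pred]; push_cast; ring)
  have h2 : ∏ i ∈ Icc 1 N, rp (ν i - ν (N + 1) + 1) (l i - (k + e N) (i - 1)) =
      ∏ i ∈ Icc 1 N, rp (ν i - ν (N + 1) + 1) (l i - k (i - 1)) :=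
    Finset.prod_congr rfl fun i hi => by
      have := Finset.mem_Icc.1 hi
      simp [e_ne (show i - 1 ≠ N by omega)]
  have h3 : rf (m (N + 1) - (k + e N) N) = ((m (N + 1) : ℂ) - k N) * rf (m (N + 1) - k N) := by
    simp only [Pi.add_apply, e_self]
    rw [show m (N + 1) - (k N + 1) = (m (N + 1) - k N) - 1 by ring, rf_pred]; push_cast; ring
  rw [one_mul] at h1
  unfold F
  rw [h1, h2, h3]
  ring

lemma F_l (hg : Good ν N) (m l k : ℕ → ℤ) {j : ℕ} (hj : j ∈ Icc 1 N) :
    (((l + e j) j : ℂ) - k j) * (ν j - ν (N + 1) + ((l + e j) j : ℤ) - k (j - 1)) *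
        F ν N m (l + e j) k =
      ((m j : ℂ) - l j) * (ν (j + 1) + ν (N + 1) + m (j + 1) - l j) * F ν N m l k := by
  have hj' := Finset.mem_Icc.1 hj
  have h1 := prod_one_change hj (f := fun i => rf (m i - (l + e j) i))
    (g := fun i => rf (m i - l i)) (c := 1) (d := (m j : ℂ) - l j)
    (fun i _ hi => by simp [e_ne hi]) (by
      simp only [Pi.add_apply, e_self]
      rw [show m j - (l j + 1) = (m j - l j) - 1 by ring, rf_pred]; push_cast; ring)
  have h2 := prod_one_change hj (f := fun i => rf ((l + e j) i - k i))
    (g := fun i => rf (l i - k i)) (c := (l j : ℂ) + 1 - k j) (d := 1)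
    (fun i _ hi => by simp [e_ne hi]) (by
      simp only [Pi.add_apply, e_self]
      rw [show l j - k j = (l j + 1 - k j) - 1 by ring, rf_pred]; push_cast; ring)
  have h3 := prod_one_change hj
    (f := fun i => rp (ν i - ν (N + 1) + 1) ((l + e j) i - k (i - 1)))
    (g := fun i => rp (ν i - ν (N + 1) + 1) (l i - k (i - 1)))
    (c := ν j - ν (N + 1) + l j + 1 - k (j - 1)) (d := 1)
    (fun i _ hi => by simp [e_ne hi]) (by
      simp only [Pi.add_apply, e_self]
      rw [show l j - k (j - 1) = (l j + 1 - k (j - 1)) - 1 by ring, rp_pred (hg.minus j hj)]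
      push_cast; ring)
  have hj2 : j + 1 ∈ Icc 1 (N + 1) := Finset.mem_Icc.2 ⟨by omega, by omega⟩
  have h4 := prod_one_change hj2
    (f := fun i => rp (ν i + ν (N + 1) + 1) (m i - (l + e j) (i - 1)))
    (g := fun i => rp (ν i + ν (N + 1) + 1) (m i - l (i - 1))) (c := 1)
    (d := ν (j + 1) + ν (N + 1) + m (j + 1) - l j)
    (fun i hi' hi => by
      have := Finset.mem_Icc.1 hi'
      simp [e_ne (show i - 1 ≠ j by omega)]) (by
      simp only [Pi.add_apply, e_self, Nat.add_sub_cancel]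
      rw [show m (j + 1) - (l j + 1) = (m (j + 1) - l j) - 1 by ring, rp_pred (hg.plus _ hj2)]
      push_cast; ring)
  rw [one_mul] at h1 h4
  rw [one_mul] at h2 h3
  have h5 : (((l + e j) j : ℤ) : ℂ) = l j + 1 := by simp [e_self]
  rw [h5]
  unfold F
  rw [h1, h4, ← h2, ← h3]
  ring

lemma poly_bulk (u : ℂ) (ν m l k : ℕ → ℂ) (hl : l 0 = 0) (hk : k 0 = 0) (N : ℕ) :
    ∑ i ∈ Icc 1 (N + 1), (m i ^ 2 - m i * m (i + 1) + (ν i - ν (i + 1)) * m i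
        - (m i - l i) * (ν i + u + m i - l (i - 1))
        + (m i - l i) * (ν (i + 1) + u + m (i + 1) - l i)
        - (l i - k i) * (ν i - u + l i - k (i - 1)))
      + ∑ i ∈ Icc 1 N, (-(k i ^ 2) + k i * k (i + 1) - (ν i - ν (i + 1)) * k i
        + (l i - k i) * (ν (i + 1) - u + l (i + 1) - k i))
      = - l (N + 1) * ν (N + 2) + u * l (N + 1) + k (N + 1) * ν (N + 1) - u * k (N + 1)
        + k (N + 1) * l (N + 1) - m (N + 2) * l (N + 1) := by
  induction N with
  | zero => simp [hl, hk]; ring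
  | succ N ih =>
    rw [Finset.sum_Icc_succ_top (b := N + 1) (by omega)]
    generalize ∑ i ∈ Icc 1 (N + 1), (m i ^ 2 - m i * m (i + 1) + (ν i - ν (i + 1)) * m i
        - (m i - l i) * (ν i + u + m i - l (i - 1))
        + (m i - l i) * (ν (i + 1) + u + m (i + 1) - l i)
        - (l i - k i) * (ν i - u + l i - k (i - 1))) = X at ih ⊢
    rw [Finset.sum_Icc_succ_top (b := N) (by omega)]
    simp only [Nat.add_sub_cancel]
    linear_combination ih

lemma poly_id (hN : 1 ≤ N) (m l k : ℕ → ℤ) (hl : l 0 = 0) (hk : k 0 = 0) :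
    qZ (N + 1) m ν =
      ∑ i ∈ Icc 1 N, ((m i : ℂ) - l i) * (ν i + ν (N + 1) + m i - l (i - 1))
      + 1 / 2 * (((m (N + 1) : ℂ) - k N) * (2 * ν (N + 1) + m (N + 1) - l N))
      + qZ N k ν
      - ∑ i ∈ Icc 1 (N - 1), ((l i : ℂ) - k i) * (ν (i + 1) - ν (N + 1) + l (i + 1) - k i)
      - 1 / 2 * (((m (N + 1) : ℂ) - k N) * (l N - k N))
      - ∑ i ∈ Icc 1 N, (((m i : ℂ) - l i) * (ν (i + 1) + ν (N + 1) + m (i + 1) - l i))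
      + ∑ i ∈ Icc 1 N, (((l i : ℂ) - k i) * (ν i - ν (N + 1) + l i - k (i - 1))) := by
  obtain ⟨N, rfl⟩ : ∃ M, N = M + 1 := ⟨N - 1, by omega⟩
  have h := poly_bulk (ν (N + 2)) ν (fun i => (m i : ℂ)) (fun i => (l i : ℂ)) (fun i => (k i : ℂ))
    (by simp [hl]) (by simp [hk]) N
  simp only [Finset.sum_add_distrib, Finset.sum_sub_distrib, Finset.sum_neg_distrib] at h
  simp only [qZ, Nat.add_sub_cancel]
  linear_combination h

lemma cB_succ (n : ℕ) (hn : 1 ≤ n) (ν : ℕ → ℂ) (m : ℕ → ℕ) (hm : 0 < ∑ i ∈ Icc 1 n, m i) :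
    cB n ν m = ((∑ i ∈ Icc 1 (n - 1), if m i = 0 then 0 else cB n ν (dec m i))
        + (1 / 2) * (if m n = 0 then 0 else cB n ν (dec m n))) / qB n m ν := by
  obtain ⟨d, hd⟩ : ∃ d, ∑ i ∈ Icc 1 n, m i = d + 1 := ⟨_, (Nat.succ_pred_eq_of_pos hm).symm⟩
  have key : ∀ i ∈ Icc 1 n, m i ≠ 0 → ∑ j ∈ Icc 1 n, dec m i j = d := by
    intro i hi h0
    rw [← Finset.add_sum_erase _ _ hi] at hd ⊢
    have : ∑ x ∈ (Icc 1 n).erase i, dec m i x = ∑ x ∈ (Icc 1 n).erase i, m x :=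
      Finset.sum_congr rfl fun x hx => by
        simp [dec, Function.update_of_ne (Finset.ne_of_mem_erase hx)]
    rw [this]
    simp only [dec, Function.update_self]
    omega
  have key2 : ∀ i ∈ Icc 1 n, (if m i = 0 then 0 else cAux n ν d (dec m i)) =
      (if m i = 0 then 0 else cB n ν (dec m i)) := by
    intro i hi
    split_ifs with h
    · rfl
    · rw [cB, key i hi h]
  rw [cB, hd, cAux]
  congr 2
  · refine Finset.sum_congr rfl fun i hi => key2 i ?_
    rw [Finset.mem_Icc] at hi ⊢; omega
  · rw [key2 n (Finset.mem_Icc.2 ⟨hn, le_rfl⟩)]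

/-- The nonnegative vectors supported in `[1, N]`. -/
def Adm (N : ℕ) (k : ℕ → ℤ) : Prop := (∀ i, 0 ≤ k i) ∧ ∀ i, i ∉ Icc 1 N → k i = 0

open Classical in
/-- Extension by zero of the coefficients. -/
def cZ (N : ℕ) (ν : ℕ → ℂ) (k : ℕ → ℤ) : ℂ :=
  if Adm N k then cB N ν (fun i => (k i).toNat) else 0

open Classical in
/-- Indicator of being supported in `[1, N]`. -/
def ind (N : ℕ) (l : ℕ → ℤ) : ℂ := if ∀ i, i ∉ Icc 1 N → l i = 0 then 1 else 0

lemma ind_shift (l : ℕ → ℤ) {j : ℕ} (hj : j ∈ Icc 1 N) : ind N (l + e j) = ind N l := by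
  unfold ind
  have : (∀ i, i ∉ Icc 1 N → (l + e j) i = 0) ↔ (∀ i, i ∉ Icc 1 N → l i = 0) := by
    refine forall_congr' fun i => forall_congr' fun hi => ?_
    have : i ≠ j := fun h => hi (h ▸ hj)
    simp [e_ne this]
  by_cases h : ∀ i, i ∉ Icc 1 N → l i = 0
  · rw [if_pos h, if_pos (this.2 h)]
  · rw [if_neg h, if_neg (fun h' => h (this.1 h'))]

lemma cZ_sub {k : ℕ → ℤ} (hk : Adm N k) {j : ℕ} (hj : j ∈ Icc 1 N) :
    cZ N ν (k - e j) = if (k j).toNat = 0 then 0 else cB N ν (dec (fun i => (k i).toNat) j) := by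
  unfold cZ
  have h0 := hk.1 j
  by_cases h : (k j).toNat = 0
  · rw [if_pos h, if_neg]
    intro h'
    have := h'.1 j
    simp [e_self] at this
    omega
  · rw [if_neg h, if_pos]
    · congr 1
      funext i
      by_cases hi : i = j
      · subst hi; simp [dec, e_self]
      · simp [dec, e_ne hi, Function.update_of_ne hi]
    · constructor
      · intro i
        by_cases hi : i = j
        · subst hi; simp [e_self]; omega
        · simp [e_ne hi, hk.1 i]
      · intro i hi
        have : i ≠ j := fun h => hi (h ▸ hj)
        simp [e_ne this, hk.2 i hi]

lemma cZ_rec (hN : 1 ≤ N)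
    (hq : ∀ k : ℕ → ℕ, 0 < ∑ i ∈ Icc 1 N, k i → qB N k ν ≠ 0) (k : ℕ → ℤ) :
    qZ N k ν * cZ N ν k = ∑ i ∈ Icc 1 (N - 1), cZ N ν (k - e i) + 1 / 2 * cZ N ν (k - e N) := by
  have hNN : N ∈ Icc 1 N := Finset.mem_Icc.2 ⟨hN, le_rfl⟩
  have hsub : ∀ i ∈ Icc 1 (N - 1), i ∈ Icc 1 N := fun i hi => by
    rw [Finset.mem_Icc] at hi ⊢; omega
  by_cases hk : Adm N k
  · have hq' : qZ N k ν = qB N (fun i => (k i).toNat) ν := by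
      rw [qB_eq_qZ]; congr 1; funext i; simp [hk.1 i]
    rw [cZ_sub hk hNN, Finset.sum_congr rfl fun i hi => cZ_sub hk (hsub i hi)]
    rw [cZ, if_pos hk, hq']
    by_cases hs : 0 < ∑ i ∈ Icc 1 N, (k i).toNat
    · rw [cB_succ N hN ν _ hs, mul_div_cancel₀]
      exact hq _ hs
    · have hz : ∀ i ∈ Icc 1 N, (k i).toNat = 0 := by
        have := Nat.eq_zero_of_not_pos hs
        exact Finset.sum_eq_zero_iff.1 this
      have h1 : (fun i => (k i).toNat) = fun _ => 0 := by
        funext i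
        by_cases hi : i ∈ Icc 1 N
        · exact hz i hi
        · simp [hk.2 i hi]
      rw [if_pos (hz N hNN), Finset.sum_congr rfl fun i hi => if_pos (hz i (hsub i hi)), h1]
      simp [qB]
  · have hk' : ∀ i ∈ Icc 1 N, cZ N ν (k - e i) = 0 := by
      intro i hi
      rw [cZ, if_neg]
      intro h
      apply hk
      constructor
      · intro j
        have := h.1 j
        by_cases hj : j = i
        · subst hj; simp [e_self] at this; omega
        · simpa [e_ne hj] using this
      · intro j hj
        have := h.2 j hj
        have hji : j ≠ i := fun h => hj (h ▸ hi)
        simpa [e_ne hji] using this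
    rw [hk' N hNN, Finset.sum_congr rfl fun i hi => hk' i (hsub i hi), cZ, if_neg hk]
    simp

/-- The summand. -/
def phi (ν : ℕ → ℂ) (N : ℕ) (m : ℕ → ℤ) (p : (ℕ → ℤ) × (ℕ → ℤ)) : ℂ :=
  ind N p.1 * cZ N ν p.2 * F ν N m p.1 p.2

lemma phi_ne {m : ℕ → ℤ} {p : (ℕ → ℤ) × (ℕ → ℤ)} (h : phi ν N m p ≠ 0) :
    (∀ i, i ∉ Icc 1 N → p.1 i = 0) ∧ Adm N p.2 ∧
      (∀ i ∈ Icc 1 N, p.2 i ≤ p.1 i ∧ p.1 i ≤ m i) ∧ p.2 N ≤ m (N + 1) := by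
  unfold phi at h
  have h1 := left_ne_zero_of_mul (left_ne_zero_of_mul h)
  have h2 := right_ne_zero_of_mul (left_ne_zero_of_mul h)
  have h3 := right_ne_zero_of_mul h
  unfold F at h3
  have h4 := right_ne_zero_of_mul h3
  have h5 := left_ne_zero_of_mul (left_ne_zero_of_mul (left_ne_zero_of_mul h3))
  have h6 := Finset.prod_ne_zero_iff.1 (left_ne_zero_of_mul h5)
  have h7 := Finset.prod_ne_zero_iff.1 (right_ne_zero_of_mul h5)
  refine ⟨?_, ?_, ?_, ?_⟩
  · by_contra hc; exact h1 (if_neg hc)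
  · by_contra hc; exact h2 (if_neg hc)
  · intro i hi
    constructor
    · by_contra hc; exact h7 i hi (rf_neg (by omega))
    · by_contra hc; exact h6 i hi (rf_neg (by omega))
  · by_contra hc; exact h4 (rf_neg (by omega))

lemma box_finite (N : ℕ) (m : ℕ → ℤ) :
    {f : ℕ → ℤ | (∀ i, i ∉ Icc 1 N → f i = 0) ∧ ∀ i ∈ Icc 1 N, 0 ≤ f i ∧ f i ≤ m i}.Finite := by
  refine Set.Finite.of_finite_image (f := fun f (i : Icc 1 N) => f i)
    (Set.Finite.subset (Set.finite_Icc (0 : Icc 1 N → ℤ) (fun i => m i)) ?_) ?_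
  · rintro _ ⟨f, hf, rfl⟩
    exact ⟨fun i => (hf.2 i i.2).1, fun i => (hf.2 i i.2).2⟩
  · intro f hf g hg h
    funext i
    by_cases hi : i ∈ Icc 1 N
    · exact congrFun h ⟨i, hi⟩
    · rw [hf.1 i hi, hg.1 i hi]

lemma phi_finite (m : ℕ → ℤ) : (Function.support (phi ν N m)).Finite := by
  refine Set.Finite.subset ((box_finite N m).prod (box_finite N m)) ?_
  intro p hp
  obtain ⟨h1, h2, h3, h4⟩ := phi_ne hp
  refine ⟨⟨h1, fun i hi => ?_⟩, h2.2, fun i hi => ?_⟩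
  · have := h2.1 i; have := h3 i hi; omega
  · have := h2.1 i; have := h3 i hi; omega

lemma summ (m : ℕ → ℤ) (P : (ℕ → ℤ) × (ℕ → ℤ) → ℂ) : Summable fun p => P p * phi ν N m p := by
  refine summable_of_hasFiniteSupport ((phi_finite (ν := ν) (N := N) m).subset ?_)
  intro p hp
  exact right_ne_zero_of_mul hp

/-- Weighted sum as a linear functional. -/
def E (ν : ℕ → ℂ) (N : ℕ) (m : ℕ → ℤ) : ((ℕ → ℤ) × (ℕ → ℤ) → ℂ) →ₗ[ℂ] ℂ where
  toFun P := ∑' p, P p * phi ν N m p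
  map_add' P Q := by
    rw [← (summ m P).tsum_add (summ m Q)]
    simp [add_mul]
  map_smul' c P := by
    simp only [Pi.smul_apply, smul_eq_mul, mul_assoc, RingHom.id_apply, tsum_mul_left]

/-- The sum. -/
def S (ν : ℕ → ℂ) (N : ℕ) (m : ℕ → ℤ) : ℂ := ∑' p, phi ν N m p

lemma S_rec (hg : Good ν N) (hN : 1 ≤ N)
    (hq : ∀ k : ℕ → ℕ, 0 < ∑ i ∈ Icc 1 N, k i → qB N k ν ≠ 0) (m : ℕ → ℤ) :
    qZ (N + 1) m ν * S ν N m =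
      ∑ i ∈ Icc 1 N, S ν N (m - e i) + 1 / 2 * S ν N (m - e (N + 1)) := by
  let A : ℕ → (ℕ → ℤ) × (ℕ → ℤ) → ℂ := fun i p =>
    ((m i : ℂ) - p.1 i) * (ν i + ν (N + 1) + m i - p.1 (i - 1))
  let A' : (ℕ → ℤ) × (ℕ → ℤ) → ℂ := fun p =>
    ((m (N + 1) : ℂ) - p.2 N) * (2 * ν (N + 1) + m (N + 1) - p.1 N)
  let Q : (ℕ → ℤ) × (ℕ → ℤ) → ℂ := fun p => qZ N p.2 ν
  let B : ℕ → (ℕ → ℤ) × (ℕ → ℤ) → ℂ := fun i p =>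
    ((p.1 i : ℂ) - p.2 i) * (ν (i + 1) - ν (N + 1) + p.1 (i + 1) - p.2 i)
  let B' : (ℕ → ℤ) × (ℕ → ℤ) → ℂ := fun p =>
    ((m (N + 1) : ℂ) - p.2 N) * (p.1 N - p.2 N)
  let C : ℕ → (ℕ → ℤ) × (ℕ → ℤ) → ℂ := fun i p =>
    ((m i : ℂ) - p.1 i) * (ν (i + 1) + ν (N + 1) + m (i + 1) - p.1 i)
  let D : ℕ → (ℕ → ℤ) × (ℕ → ℤ) → ℂ := fun i p =>
    ((p.1 i : ℂ) - p.2 i) * (ν i - ν (N + 1) + p.1 i - p.2 (i - 1))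
  have hA : ∀ i ∈ Icc 1 N, S ν N (m - e i) = E ν N m (A i) := fun i hi => by
    refine tsum_congr fun p => ?_
    simp only [phi, F_m hg m p.1 p.2 hi, A]; ring
  have hA' : S ν N (m - e (N + 1)) = E ν N m A' := by
    refine tsum_congr fun p => ?_
    simp only [phi, F_m_last hg m p.1 p.2, A']; ring
  have hCD : ∀ i ∈ Icc 1 N, E ν N m (C i) = E ν N m (D i) := fun i hi => by
    change ∑' p, C i p * phi ν N m p = ∑' p, D i p * phi ν N m p
    rw [← (Equiv.addRight ((e i, 0) : (ℕ → ℤ) × (ℕ → ℤ))).tsum_eq (fun p => D i p * phi ν N m p)]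
    refine tsum_congr fun p => ?_
    have := F_l hg m p.1 p.2 hi
    simp only [phi, C, D, Equiv.coe_addRight, Prod.fst_add, Prod.snd_add, add_zero,
      ind_shift p.1 hi] at this ⊢
    linear_combination -(ind N p.1 * cZ N ν p.2) * this
  -- the shift in `k`
  have hshift : ∀ (i : ℕ) (X : (ℕ → ℤ) × (ℕ → ℤ) → ℂ),
      (∀ p : (ℕ → ℤ) × (ℕ → ℤ), F ν N m p.1 (p.2 + e i) = X p * F ν N m p.1 p.2) →
      HasSum (fun p : (ℕ → ℤ) × (ℕ → ℤ) => ind N p.1 * cZ N ν (p.2 - e i) * F ν N m p.1 p.2)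
        (E ν N m X) := fun i X hX => by
    rw [← (Equiv.addRight ((0, e i) : (ℕ → ℤ) × (ℕ → ℤ))).hasSum_iff]
    change HasSum _ (∑' p, X p * phi ν N m p)
    convert (summ (ν := ν) (N := N) m X).hasSum using 1
    funext p
    simp only [Function.comp, Equiv.coe_addRight, Prod.fst_add, Prod.snd_add, add_zero,
      add_sub_cancel_right, hX p, phi]
    ring
  have hQ : E ν N m Q = ∑ i ∈ Icc 1 (N - 1), E ν N m (B i) + 1 / 2 * E ν N m B' := by
    have h1 := hasSum_sum (s := Icc 1 (N - 1)) fun i hi =>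
      hshift i (B i) (fun p => F_k hg m p.1 p.2 hi)
    have h2 := (hshift N B' (fun p => F_k_last hN m p.1 p.2)).mul_left (1 / 2)
    rw [← (h1.add h2).tsum_eq]
    refine tsum_congr fun p => ?_
    have := cZ_rec (ν := ν) hN hq p.2
    simp only [Q, phi]
    rw [← Finset.sum_mul, ← Finset.mul_sum]
    linear_combination (ind N p.1 * F ν N m p.1 p.2) * this
  have hmain : qZ (N + 1) m ν * S ν N m = E ν N m (∑ i ∈ Icc 1 N, A i + (1 / 2 : ℂ) • A' + Q
      - ∑ i ∈ Icc 1 (N - 1), B i - (1 / 2 : ℂ) • B' - ∑ i ∈ Icc 1 N, C i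
      + ∑ i ∈ Icc 1 N, D i) := by
    rw [S, ← tsum_mul_left]
    refine tsum_congr fun p => ?_
    by_cases hp : phi ν N m p = 0
    · rw [hp]; simp
    · obtain ⟨h1, h2, -, -⟩ := phi_ne hp
      congr 1
      rw [poly_id hN m p.1 p.2 (h1 0 (by simp)) (h2.2 0 (by simp))]
      simp only [Pi.add_apply, Pi.sub_apply, Pi.smul_apply, Finset.sum_apply, smul_eq_mul,
        A, A', Q, B, B', C, D]
  rw [hmain]
  simp only [map_add, map_sub, map_sum, map_smul, smul_eq_mul]
  rw [hQ, hA', Finset.sum_congr rfl hA, Finset.sum_congr rfl hCD]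
  ring

lemma S_neg {m : ℕ → ℤ} {i : ℕ} (hi : i ∈ Icc 1 (N + 1)) (h : m i < 0) :
    S ν N m = 0 := by
  have : ∀ p, phi ν N m p = 0 := by
    intro p
    by_contra hp
    obtain ⟨h1, h2, h3, h4⟩ := phi_ne hp
    by_cases hi' : i = N + 1
    · subst hi'
      have := h2.1 N
      omega
    · have hi2 : i ∈ Icc 1 N := by rw [Finset.mem_Icc] at hi ⊢; omega
      have := h2.1 i
      have := h3 i hi2
      omega
  simp [S, this]

lemma S_zero (hg : Good ν N) {m : ℕ → ℤ} (hm : ∀ i ∈ Icc 1 (N + 1), m i = 0) :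
    S ν N m = 1 := by
  have hm' : ∀ i ∈ Icc 1 N, m i = 0 := fun i hi => hm i (by rw [Finset.mem_Icc] at hi ⊢; omega)
  rw [S, tsum_eq_single (0 : (ℕ → ℤ) × (ℕ → ℤ))]
  · have h1 : ind N (0 : ℕ → ℤ) = 1 := by simp [ind]
    have h2 : cZ N ν (0 : ℕ → ℤ) = 1 := by simp [cZ, Adm, cB, cAux]
    simp only [phi, Prod.fst_zero, Prod.snd_zero, h1, h2, F]
    rw [Finset.prod_eq_one, Finset.prod_eq_one, Finset.prod_eq_one, Finset.prod_eq_one,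
      hm (N + 1) (by simp)]
    · simp [rf_zero]
    · intro i hi; rw [hm i hi]; simpa using rp_zero (hg.plus i hi)
    · intro i hi; simpa using rp_zero (hg.minus i hi)
    · intro i hi; simp [rf_zero]
    · intro i hi; simp [hm' i hi, rf_zero]
  · intro p hp
    by_contra hp'
    obtain ⟨h1, h2, h3, h4⟩ := phi_ne hp'
    apply hp
    ext i
    · by_cases hi : i ∈ Icc 1 N
      · have := h2.1 i; have := h3 i hi; have := hm' i hi
        change p.1 i = 0; omega
      · exact h1 i hi
    · by_cases hi : i ∈ Icc 1 N
      · have := h2.1 i; have := h3 i hi; have := hm' i hi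
        change p.2 i = 0; omega
      · exact h2.2 i hi

lemma cB_eq_S (hg : Good ν N) (hN : 1 ≤ N)
    (hq : ∀ k : ℕ → ℕ, 0 < ∑ i ∈ Icc 1 N, k i → qB N k ν ≠ 0)
    (hq' : ∀ k : ℕ → ℕ, 0 < ∑ i ∈ Icc 1 (N + 1), k i → qB (N + 1) k ν ≠ 0) (d : ℕ) :
    ∀ m : ℕ → ℕ, ∑ i ∈ Icc 1 (N + 1), m i = d → cB (N + 1) ν m = S ν N (fun i => (m i : ℤ)) := by
  induction d with
  | zero =>
    intro m hm
    rw [S_zero hg, cB, hm, cAux]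
    intro i hi
    exact_mod_cast Finset.sum_eq_zero_iff.1 hm i hi
  | succ d ih =>
    intro m hm
    have hpos : 0 < ∑ i ∈ Icc 1 (N + 1), m i := by omega
    have key : ∀ i ∈ Icc 1 (N + 1), (if m i = 0 then 0 else cB (N + 1) ν (dec m i)) =
        S ν N ((fun i => (m i : ℤ)) - e i) := by
      intro i hi
      split_ifs with h
      · rw [S_neg hi]; simp [e_self, h]
      · rw [ih]
        · congr 1
          funext j
          by_cases hj : j = i
          · subst hj
            simp only [dec, Function.update_self, Pi.sub_apply, e_self]
            omega
          · simp [dec, Function.update_of_ne hj, e_ne hj]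
        · rw [← Finset.add_sum_erase _ _ hi] at hm ⊢
          have : ∑ x ∈ (Icc 1 (N + 1)).erase i, dec m i x = ∑ x ∈ (Icc 1 (N + 1)).erase i, m x :=
            Finset.sum_congr rfl fun x hx => by
              simp [dec, Function.update_of_ne (Finset.ne_of_mem_erase hx)]
          rw [this]
          simp only [dec, Function.update_self]
          omega
    rw [cB_succ _ (by omega) ν m hpos, div_eq_iff (hq' m hpos), qB_eq_qZ, mul_comm (S ν N _),
      S_rec hg hN hq, key (N + 1) (by simp), Nat.add_sub_cancel]
    congr 1
    refine Finset.sum_congr rfl fun i hi => key i ?_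
    rw [Finset.mem_Icc] at hi ⊢; omega

end

lemma wAct_fin (n : ℕ) (w : SignedPerm n) (ν : ℕ → ℂ) (a : Fin n) :
    wAct n w ν (a + 1) = (if w.2 a then -1 else 1) * ν ((w.1 a : Fin n).val + 1) := by
  unfold wAct
  rw [dif_pos ⟨by omega, by omega⟩]
  rfl

lemma wAct_one (n : ℕ) (ν : ℕ → ℂ) : wAct n (1, fun _ => false) ν = ν := by
  funext i
  by_cases h : 1 ≤ i ∧ i ≤ n
  · simp [wAct, h, Nat.sub_add_cancel h.1]
  · simp [wAct, h]

lemma sum_Icc_shift {M : Type*} [AddCommMonoid M] (f : ℕ → M) (p : ℕ) :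
    ∑ i ∈ Icc 1 (p + 1), f i = f 1 + ∑ i ∈ Icc 1 p, f (i + 1) := by
  induction p with
  | zero => simp
  | succ p ih => rw [Finset.sum_Icc_succ_top (by omega), ih, Finset.sum_Icc_succ_top (by omega),
      add_assoc]

lemma reg_q {n : ℕ} {ν : ℕ → ℂ} (h : Regular n ν) (k : ℕ → ℕ) (hk : 0 < ∑ i ∈ Icc 1 n, k i) :
    qB n k ν ≠ 0 := by
  have := h.1 (1, fun _ => false) k hk
  rwa [wAct_one] at this

lemma reg_q' {p : ℕ} {ν : ℕ → ℂ} (h : Regular (p + 2) ν) (k : ℕ → ℕ)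
    (hk : 0 < ∑ i ∈ Icc 1 (p + 1), k i) : qB (p + 1) k ν ≠ 0 := by
  set w : SignedPerm (p + 2) := ((finRotate (p + 2)).symm, fun _ => false) with hw
  set m : ℕ → ℕ := fun i => if i ≤ 1 then 0 else k (i - 1) with hm
  have hm1 : m 1 = 0 := by simp [hm]
  have hms : ∀ i ∈ Icc 1 (p + 1), m (i + 1) = k i := by
    intro i hi
    rw [Finset.mem_Icc] at hi
    simp only [hm]
    rw [if_neg (by omega), Nat.add_sub_cancel]
  have hws : ∀ i ∈ Icc 1 (p + 1), wAct (p + 2) w ν (i + 1) = ν i := by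
    intro i hi
    rw [Finset.mem_Icc] at hi
    obtain ⟨j, rfl⟩ : ∃ j, i = j + 1 := ⟨i - 1, by omega⟩
    have h1 := wAct_fin (p + 2) w ν ⟨j + 1, by omega⟩
    have h2 : (finRotate (p + 2)).symm ⟨j + 1, by omega⟩ = ⟨j, by omega⟩ := by
      rw [Equiv.symm_apply_eq, finRotate_of_lt (by omega)]
    simp only [hw, h2] at h1
    simpa using h1
  have hsub : ∀ i ∈ Icc 1 p, i ∈ Icc 1 (p + 1) ∧ i + 1 ∈ Icc 1 (p + 1) := by
    intro i hi
    simp only [Finset.mem_Icc] at hi ⊢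
    omega
  have hlast : p + 1 ∈ Icc 1 (p + 1) := by simp
  have hpos : 0 < ∑ i ∈ Icc 1 (p + 2), m i := by
    rw [sum_Icc_shift, hm1, Finset.sum_congr rfl hms, zero_add]; exact hk
  have := h.1 w m hpos
  convert this using 1
  unfold qB
  rw [show p + 2 - 1 = p + 1 by omega, Nat.add_sub_cancel, sum_Icc_shift, sum_Icc_shift,
    sum_Icc_shift, hm1, hms _ hlast, hws _ hlast]
  have s1 : ∑ i ∈ Icc 1 p, (m (i + 1) : ℂ) ^ 2 = ∑ i ∈ Icc 1 p, (k i : ℂ) ^ 2 :=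
    Finset.sum_congr rfl fun i hi => by rw [hms i (hsub i hi).1]
  have s2 : ∑ i ∈ Icc 1 p, (m (i + 1) : ℂ) * (m (i + 1 + 1) : ℂ) =
      ∑ i ∈ Icc 1 p, (k i : ℂ) * (k (i + 1) : ℂ) :=
    Finset.sum_congr rfl fun i hi => by rw [hms i (hsub i hi).1, hms _ (hsub i hi).2]
  have s3 : ∑ i ∈ Icc 1 p, (wAct (p + 2) w ν (i + 1) - wAct (p + 2) w ν (i + 1 + 1)) *
      (m (i + 1) : ℂ) = ∑ i ∈ Icc 1 p, (ν i - ν (i + 1)) * (k i : ℂ) :=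
    Finset.sum_congr rfl fun i hi => by
      rw [hms i (hsub i hi).1, hws i (hsub i hi).1, hws _ (hsub i hi).2]
  rw [s1, s2, s3]
  simp

lemma reg_fin {n : ℕ} {ν : ℕ → ℂ} (h : Regular n ν) (w : SignedPerm n)
    (hw : w ≠ (1, fun _ => false)) :
    ∃ a : Fin n, ∀ k : ℤ, wAct n w ν (a + 1) - ν (a + 1) ≠ k := by
  by_contra hc
  push Not at hc
  apply h.2 w (1, fun _ => false) hw
  intro i hi
  rw [Finset.mem_Icc] at hi
  obtain ⟨k, hk⟩ := hc ⟨i - 1, by omega⟩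
  refine ⟨k, ?_⟩
  rw [wAct_one, ← hk]
  simp [Nat.sub_add_cancel hi.1]

lemma reg_good {N : ℕ} {ν : ℕ → ℂ} (h : Regular (N + 1) ν) : Good ν N := by
  constructor
  · intro i hi z hz
    rw [Finset.mem_Icc] at hi
    obtain ⟨a, rfl⟩ : ∃ a, i = a + 1 := ⟨i - 1, by omega⟩
    let b : Fin (N + 1) := ⟨a, by omega⟩
    have hb : b ≠ Fin.last N := by simp [b, Fin.ext_iff]; omega
    obtain ⟨c, hc⟩ := reg_fin h (Equiv.swap b (Fin.last N), fun _ => false) (by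
      intro hh
      have := congrArg (fun w => w.1 b) hh
      simp at this
      exact hb this.symm)
    rw [wAct_fin] at hc
    by_cases h1 : c = b
    · subst h1
      apply hc (1 - z)
      simp only [Equiv.swap_apply_left, Fin.val_last, b]
      push_cast
      simp
      linear_combination -hz
    · by_cases h2 : c = Fin.last N
      · subst h2
        apply hc (z - 1)
        simp only [Equiv.swap_apply_right, Fin.val_last, b]
        push_cast
        simp
        linear_combination hz
      · apply hc 0
        simp only [Equiv.swap_apply_of_ne_of_ne h1 h2]
        simp
  · intro i hi z hz
    rw [Finset.mem_Icc] at hi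
    obtain ⟨a, rfl⟩ : ∃ a, i = a + 1 := ⟨i - 1, by omega⟩
    let b : Fin (N + 1) := ⟨a, by omega⟩
    obtain ⟨c, hc⟩ := reg_fin h
        (Equiv.swap b (Fin.last N), fun c => decide (c = b ∨ c = Fin.last N)) (by
      intro hh
      have := congrArg (fun w => w.2 b) hh
      simp at this)
    rw [wAct_fin] at hc
    by_cases h1 : c = b
    · subst h1
      apply hc (1 - z)
      simp only [Equiv.swap_apply_left, Fin.val_last, b]
      push_cast
      simp
      linear_combination -hz
    · by_cases h2 : c = Fin.last N
      · subst h2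
        apply hc (1 - z)
        simp only [Equiv.swap_apply_right, Fin.val_last, b]
        push_cast
        simp
        linear_combination -hz
      · apply hc 0
        simp only [Equiv.swap_apply_of_ne_of_ne h1 h2]
        simp [h1, h2]

/-- Reindexing map. -/
def Phi (p : ℕ) (x : (Fin (p + 2) → ℕ) × (Fin p → ℕ)) : (ℕ → ℤ) × (ℕ → ℤ) :=
  (fun i => if i ≤ p + 1 then (extN (p + 2) x.1 i : ℤ) else 0,
    fun i => if i = p + 1 then (extN (p + 2) x.1 (p + 2) : ℤ) else (extN p x.2 i : ℤ))

lemma extN_fin (n : ℕ) (l : Fin n → ℕ) (a : Fin n) : extN n l (a + 1) = l a := by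
  unfold extN; rw [dif_pos ⟨by omega, by omega⟩]; rfl

lemma extN_out (n : ℕ) (l : Fin n → ℕ) (i : ℕ) (h : ¬ (1 ≤ i ∧ i ≤ n)) : extN n l i = 0 := by
  unfold extN; rw [dif_neg h]

lemma extN_ofFun (n : ℕ) (f : ℕ → ℕ) (i : ℕ) (h : 1 ≤ i ∧ i ≤ n) :
    extN n (fun a => f (a + 1)) i = f i := by
  unfold extN; rw [dif_pos h]; simp [Nat.sub_add_cancel h.1]

lemma Phi_inj (p : ℕ) : Function.Injective (Phi p) := by
  rintro ⟨l, k⟩ ⟨l', k'⟩ h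
  have h1 := congrArg Prod.fst h
  have h2 := congrArg Prod.snd h
  simp only [Phi] at h1 h2
  ext a
  · change l a = l' a
    rw [← extN_fin _ l, ← extN_fin _ l']
    by_cases ha : a.val + 1 ≤ p + 1
    · have := congrFun h1 (a + 1)
      simp only [if_pos ha] at this
      exact_mod_cast this
    · have := congrFun h2 (p + 1)
      simp only [if_true] at this
      have ha' : a.val + 1 = p + 2 := by omega
      rw [ha']
      exact_mod_cast this
  · change k a = k' a
    rw [← extN_fin _ k, ← extN_fin _ k']
    have := congrFun h2 (a + 1)
    simp only [if_neg (show a.val + 1 ≠ p + 1 by omega)] at this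
    exact_mod_cast this

lemma supp_range (p : ℕ) (ν : ℕ → ℂ) (m : ℕ → ℤ) :
    Function.support (phi ν (p + 1) m) ⊆ Set.range (Phi p) := by
  intro x hx
  obtain ⟨h1, h2, h3, -⟩ := phi_ne hx
  have h0 : ∀ i, 0 ≤ x.1 i := fun i => by
    by_cases hi : i ∈ Icc 1 (p + 1)
    · have := h3 i hi; have := h2.1 i; omega
    · rw [h1 i hi]
  refine ⟨(fun a => if a.val + 1 = p + 2 then (x.2 (p + 1)).toNat else (x.1 (a + 1)).toNat,
    fun a => (x.2 (a + 1)).toNat), ?_⟩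
  have e1 : ∀ i, 1 ≤ i ∧ i ≤ p + 2 → extN (p + 2)
      (fun a => if a.val + 1 = p + 2 then (x.2 (p + 1)).toNat else (x.1 (a + 1)).toNat) i =
      if i = p + 2 then (x.2 (p + 1)).toNat else (x.1 i).toNat := fun i hi =>
    extN_ofFun (p + 2) (fun i => if i = p + 2 then (x.2 (p + 1)).toNat else (x.1 i).toNat) i hi
  have e2 : ∀ i, 1 ≤ i ∧ i ≤ p → extN p (fun a => (x.2 (a + 1)).toNat) i = (x.2 i).toNat :=
    fun i hi => extN_ofFun p (fun i => (x.2 i).toNat) i hi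
  ext i
  · simp only [Phi]
    by_cases hi : i ∈ Icc 1 (p + 1)
    · have hi' := Finset.mem_Icc.1 hi
      rw [if_pos hi'.2, e1 i ⟨hi'.1, by omega⟩, if_neg (by omega)]
      simp [h0 i]
    · rw [h1 i hi]
      have hi' : ¬ (1 ≤ i ∧ i ≤ p + 1) := fun h => hi (Finset.mem_Icc.2 h)
      split_ifs with h
      · rw [extN_out _ _ _ (by omega)]; rfl
      · rfl
  · simp only [Phi]
    by_cases hi : i = p + 1
    · subst hi
      rw [if_pos rfl, e1 _ (by omega), if_pos rfl]
      simp [h2.1]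
    · rw [if_neg hi]
      by_cases hi' : 1 ≤ i ∧ i ≤ p
      · rw [e2 i hi']; simp [h2.1]
      · rw [extN_out _ _ _ hi', h2.2 i (by rw [Finset.mem_Icc]; omega)]; rfl

lemma phi_Phi (p : ℕ) (ν : ℕ → ℂ) (m : ℕ → ℤ) (x : (Fin (p + 2) → ℕ) × (Fin p → ℕ)) :
    phi ν (p + 1) m (Phi p x) =
      cB (p + 1) ν (fun i => if i = p + 1 then ((extN (p + 2) x.1 (p + 2) : ℤ)).toNat
          else extN p x.2 i) /
          ((∏ i ∈ Finset.Icc 1 p, zfact ((extN (p + 2) x.1 i : ℤ) - (extN p x.2 i : ℤ))) *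
            zfact ((extN (p + 2) x.1 (p + 1) : ℤ) - (extN (p + 2) x.1 (p + 2) : ℤ)) *
            ∏ i ∈ Finset.Icc 1 (p + 1),
              poch (ν i - ν (p + 2) + 1) ((extN (p + 2) x.1 i : ℤ) - (extN p x.2 (i - 1) : ℤ))) /
      ((∏ i ∈ Finset.Icc 1 (p + 2), zfact (m i - (extN (p + 2) x.1 i : ℤ))) *
            ∏ i ∈ Finset.Icc 1 (p + 2),
              poch (ν i + ν (p + 2) + 1) (m i - (extN (p + 2) x.1 (i - 1) : ℤ))) := by
  have hind : ind (p + 1) (Phi p x).1 = 1 := by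
    unfold ind
    rw [if_pos]
    intro i hi
    rw [Finset.mem_Icc] at hi
    simp only [Phi]
    split_ifs with h
    · rw [extN_out _ _ _ (by omega)]; rfl
    · rfl
  have hc : cZ (p + 1) ν (Phi p x).2 = cB (p + 1) ν (fun i => if i = p + 1 then
      ((extN (p + 2) x.1 (p + 2) : ℤ)).toNat else extN p x.2 i) := by
    unfold cZ
    rw [if_pos]
    · congr 1
      funext i
      simp only [Phi]
      split_ifs <;> simp
    · constructor
      · intro i
        simp only [Phi]
        split_ifs <;> omega
      · intro i hi
        rw [Finset.mem_Icc] at hi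
        simp only [Phi]
        rw [if_neg (by omega), extN_out _ _ _ (by omega)]; rfl
  have hl : ∀ i, i ≤ p + 1 → (Phi p x).1 i = (extN (p + 2) x.1 i : ℤ) := fun i hi => by
    simp [Phi, hi]
  have hk : ∀ i, i ≤ p → (Phi p x).2 i = (extN p x.2 i : ℤ) := fun i hi => by
    simp [Phi, (show i ≠ p + 1 by omega)]
  have hk' : (Phi p x).2 (p + 1) = (extN (p + 2) x.1 (p + 2) : ℤ) := by simp [Phi]
  rw [phi, hind, hc, F, hk', Finset.prod_Icc_succ_top (b := p) (f := fun i =>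
    rf ((Phi p x).1 i - (Phi p x).2 i)) (by omega), hk', hl _ le_rfl]
  rw [Finset.prod_congr (g := fun i => rf (m i - (extN (p + 2) x.1 i : ℤ))) rfl
    fun i hi => by rw [hl i (Finset.mem_Icc.1 hi).2]]
  rw [Finset.prod_congr (s₁ := Icc 1 p)
    (g := fun i => rf ((extN (p + 2) x.1 i : ℤ) - (extN p x.2 i : ℤ))) rfl
    fun i hi => by
      have := (Finset.mem_Icc.1 hi).2
      rw [hl i (by omega), hk i this]]
  rw [Finset.prod_congr (s₁ := Icc 1 (p + 1)) (f := fun i => rp (ν i - ν (p + 1 + 1) + 1) _)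
    (g := fun i => rp (ν i - ν (p + 2) + 1) ((extN (p + 2) x.1 i : ℤ) - (extN p x.2 (i - 1) : ℤ)))
    rfl
    fun i hi => by
      have := (Finset.mem_Icc.1 hi).2
      rw [hl i (by omega), hk (i - 1) (by omega)]]
  rw [Finset.prod_congr (s₁ := Icc 1 (p + 1 + 1))
    (g := fun i => rp (ν i + ν (p + 2) + 1) (m i - (extN (p + 2) x.1 (i - 1) : ℤ)))
    rfl
    fun i hi => by
      have := (Finset.mem_Icc.1 hi).2
      rw [hl (i - 1) (by omega)]]
  rw [Finset.prod_Icc_succ_top (b := p + 1) (f := fun i =>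
    zfact (m i - (extN (p + 2) x.1 i : ℤ))) (by omega)]
  simp only [rf, rp, Finset.prod_inv_distrib, div_eq_mul_inv, mul_inv]
  ring

lemma bB_term (p : ℕ) (ν : ℕ → ℂ) (m : ℕ → ℤ) (l : Fin (p + 2) → ℕ) :
    (-1 : ℂ) ^ (extN (p + 2) l (p + 2)) * bB (p + 2) ν (fun i => (extN (p + 2) l i : ℤ)) /
          ((∏ i ∈ Finset.Icc 1 (p + 2), zfact (m i - (extN (p + 2) l i : ℤ))) *
            ∏ i ∈ Finset.Icc 1 (p + 2),
              poch (ν i + ν (p + 2) + 1) (m i - (extN (p + 2) l (i - 1) : ℤ))) =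
      ∑' k : Fin p → ℕ, phi ν (p + 1) m (Phi p (l, k)) := by
  simp only [phi_Phi]
  rw [tsum_div_const]
  congr 1
  unfold bB
  simp only [show p + 2 - 1 = p + 1 by omega, show p + 2 - 2 = p by omega]
  split_ifs with h
  · rw [← mul_assoc, zpow_natCast, ← mul_pow]
    norm_num
    rfl
  · have h' : ¬ ((extN (p + 2) l (p + 2) : ℤ) ≤ (extN (p + 2) l (p + 1) : ℤ)) := fun hh =>
      h ⟨fun i _ => by omega, hh⟩
    have : zfact ((extN (p + 2) l (p + 1) : ℤ) - (extN (p + 2) l (p + 2) : ℤ)) = 0 := by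
      unfold zfact; rw [if_neg (by omega)]
    simp [this]

/-- the coefficients `c_{n,m}(ν)` in terms of the `b_l(ν)`. -/
theorem stmt6 (n : ℕ) (hn : 2 ≤ n) (ν : ℕ → ℂ) (hreg : Regular n ν) (m : ℕ → ℕ) :
    cB n ν m =
      ∑' l : Fin n → ℕ,
        (-1 : ℂ) ^ (extN n l n) * bB n ν (fun i => (extN n l i : ℤ)) /
          ((∏ i ∈ Finset.Icc 1 n, zfact ((m i : ℤ) - (extN n l i : ℤ))) *
            ∏ i ∈ Finset.Icc 1 n,
              poch (ν i + ν n + 1) ((m i : ℤ) - (extN n l (i - 1) : ℤ))) := by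
  obtain ⟨p, rfl⟩ : ∃ p, n = p + 2 := ⟨n - 2, by omega⟩
  rw [cB_eq_S (N := p + 1) (reg_good hreg) (by omega) (reg_q' hreg) (reg_q hreg) _ m rfl]
  rw [tsum_congr fun l => bB_term p ν (fun i => (m i : ℤ)) l]
  have hs0 : Summable (phi ν (p + 1) (fun i => (m i : ℤ))) :=
    summable_of_hasFiniteSupport (phi_finite _)
  have hs : Summable fun x => phi ν (p + 1) (fun i => (m i : ℤ)) (Phi p x) :=
    hs0.comp_injective (Phi_inj p)
  have hfib : ∀ l, Summable fun k => phi ν (p + 1) (fun i => (m i : ℤ)) (Phi p (l, k)) :=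
    fun l => hs.comp_injective (Prod.mk_right_injective l)
  rw [← hs.tsum_prod' hfib, S]
  exact ((Phi_inj p).tsum_eq (supp_range p ν _)).symm

end SO
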